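/- For every rc-graph R satisfying condition (*) and every integer 1 ≤ k ≤ n, there exist integers c > 0 ≥ d such that w_{R←k} = w_R · s_{c,d} and ℓ(w_{R←k}) = ℓ(w_R) + 1. -/

import Mathlib

open scoped Classical

noncomputable section

namespace RCGraphs

/-- The simple transposition `s j`, interchanging `j` and `j+1`. -/
def sT (j : ℤ) : Equiv.Perm ℤ := Equiv.swap j (j + 1)

/-- The Coxeter length of a permutation of `ℤ`: the minimal length of an expression
as a product of simple transpositions. -/
def len (w : Equiv.Perm ℤ) : ℕ :=
  sInf {m : ℕ | ∃ l : List ℤ, l.length = m ∧ (l.map sT).prod = w}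

/-- The permutations considered in the paper: bijections of `ℤ` fixing every `i > n`
and fixing all sufficiently small integers. -/
def IsPermZ (n : ℤ) (w : Equiv.Perm ℤ) : Prop :=
  (∀ i : ℤ, n < i → w i = i) ∧ ∃ N : ℤ, ∀ i : ℤ, i < N → w i = i

/-- The reading order on positions `(i,k)`: rows (second coordinate) from `n` downward,
and within a row in order of increasing first coordinate. -/
def rcOrder (p q : ℤ × ℤ) : Prop :=
  q.2 < p.2 ∨ (p.2 = q.2 ∧ p.1 ≤ q.1)

instance : DecidableRel rcOrder := fun p q => by
  unfold rcOrder; infer_instance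

instance : IsTrans (ℤ × ℤ) rcOrder :=
  ⟨fun a b c h₁ h₂ => by unfold rcOrder at *; omega⟩

instance : IsAntisymm (ℤ × ℤ) rcOrder :=
  ⟨fun a b h₁ h₂ => by
    unfold rcOrder at *
    have h3 : a.1 = b.1 ∧ a.2 = b.2 := by omega
    exact Prod.ext h3.1 h3.2⟩

instance : IsTotal (ℤ × ℤ) rcOrder :=
  ⟨fun a b => by unfold rcOrder; omega⟩

/-- The permutation `w_R` associated to a finite set of positions `R`: the product of the
simple transpositions `s_{i+k-n-1}`, `(i,k) ∈ R`, in the reading order. -/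
def wR (n : ℤ) (R : Finset (ℤ × ℤ)) : Equiv.Perm ℤ :=
  ((R.sort rcOrder).map fun p => sT (p.1 + p.2 - n - 1)).prod

/-- `R` is an rc-graph: positions lie in the grid `{(i,k) : i ≤ n, k ≤ n}` and the
reading word is reduced. -/
def IsRC (n : ℤ) (R : Finset (ℤ × ℤ)) : Prop :=
  (∀ p ∈ R, p.1 ≤ n ∧ p.2 ≤ n) ∧ len (wR n R) = R.card

/-- Condition (*): `w_R(i) > w_R(i-1)` for all `i ≤ 0`; equivalently no two strands with
nonpositive labels cross. -/
def Star (n : ℤ) (R : Finset (ℤ × ℤ)) : Prop :=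
  ∀ i : ℤ, i ≤ 0 → wR n R (i - 1) < wR n R i

/-- Strand labels in the wiring diagram of `R` (for diagrams all of whose crossings lie in
rows `k ≥ 1`, as is the case under condition (*)).  `lab n R true i k` is the label of the
strand entering position `(i,k)` from the west (the strand passing above, if `(i,k)` is not
a crossing); `lab n R false i k` is the label of the strand entering from the south (the
strand passing below).  Each strand is labeled by the row where it begins. -/
def lab (n : ℤ) (R : Finset (ℤ × ℤ)) : Bool → ℤ → ℤ → ℤ
  | true, i, k =>
      if h : n ≤ i then k
      else if (i + 1, k) ∈ R then lab n R true (i + 1) k else lab n R false (i + 1) k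
  | false, i, k =>
      if h : k ≤ 0 then i + k - n - 1
      else if (i, k - 1) ∈ R then lab n R false i (k - 1) else lab n R true i (k - 1)
  termination_by b i k => ((n - i).toNat + k.toNat)
  decreasing_by
    all_goals simp_wf
    all_goals omega

/-- The label of the strand leaving position `(i,r)` northward. -/
def northLabel (n : ℤ) (R : Finset (ℤ × ℤ)) (i r : ℤ) : ℤ :=
  if (i, r) ∈ R then lab n R false i r else lab n R true i r

/-- `(i,k)` is an open space: not a crossing, the strand passing below it has a
nonpositive label and the strand passing above it has a positive label. -/
def OpenSpace (n : ℤ) (R : Finset (ℤ × ℤ)) (i k : ℤ) : Prop :=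
  i ≤ n ∧ (i, k) ∉ R ∧ lab n R false i k ≤ 0 ∧ 0 < lab n R true i k

/-- The main loop of the Bergeron--Billey insertion algorithm, recording the trace:
the list of pairs (current diagram, crossing just added).  `R` always contains the
crossing `p` that was just added. -/
def insertSteps (n : ℤ) : ℕ → Finset (ℤ × ℤ) → ℤ × ℤ → List (Finset (ℤ × ℤ) × (ℤ × ℤ))
  | 0, _, _ => []
  | fuel + 1, R, p =>
      (R, p) ::
        if IsRC n R then []
        else
          let a := lab n R true p.1 p.2
          let b := lab n R false p.1 p.2
          -- the unique other crossing of the two strands that cross at `p`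
          let C := R.filter fun q =>
            q ≠ p ∧ ((lab n R true q.1 q.2 = a ∧ lab n R false q.1 q.2 = b) ∨
                     (lab n R true q.1 q.2 = b ∧ lab n R false q.1 q.2 = a))
          let q := (C.sort rcOrder).headI
          let R' := R.erase q
          let i' := sInf {x : ℤ | q.1 < x ∧ OpenSpace n R' x q.2}
          insertSteps n fuel (insert (i', q.2) R') (i', q.2)

/-- The trace of the insertion of `k` into `R`: the states of the algorithm together with
the crossings added at each step. -/
def insertStepsOf (n : ℤ) (R : Finset (ℤ × ℤ)) (k : ℤ) : List (Finset (ℤ × ℤ) × (ℤ × ℤ)) :=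
  let i₁ := sInf {x : ℤ | OpenSpace n R x k}
  insertSteps n ((n + 1 - k).toNat + 1) (insert (i₁, k) R) (i₁, k)

/-- The insertion `R ← k` of Bergeron and Billey. -/
def insertOne (n : ℤ) (R : Finset (ℤ × ℤ)) (k : ℤ) : Finset (ℤ × ℤ) :=
  ((insertStepsOf n R k).getLast?.getD (R, (0, 0))).1

/-- The insertion `R ← v` of a word. -/
def insertWord (n : ℤ) (R : Finset (ℤ × ℤ)) (v : List ℕ) : Finset (ℤ × ℤ) :=
  v.foldl (fun S a => insertOne n S (a : ℤ)) R

/-- The column (first coordinate) at which the strand labeled `a` of the diagram `R`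
leaves row `r` northward. -/
def strandCol (n : ℤ) (R : Finset (ℤ × ℤ)) (a r : ℤ) : ℤ :=
  sSup {i : ℤ | i ≤ n ∧ northLabel n R i r = a}

/-- Given the trace `L` of an insertion, the column occupied in row `r` by the left path
(`left = true`) or the right path (`left = false`) of the insertion.  Between the rows of
the `t`-th and `(t+1)`-st added crossings, the left path is the piece `s_t` of the strand
whose label changes from `a_t` to `b_t`, and the right path is the piece `s^t` whose label
changes from `b_t` to `a_t`. -/
def pathCol (n : ℤ) (L : List (Finset (ℤ × ℤ) × (ℤ × ℤ))) (left : Bool) (r : ℤ) : ℤ :=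
  match (L.filter fun e => e.2.2 ≤ r).getLast? with
  | some e => strandCol n e.1 (lab n e.1 left e.2.1 e.2.2) r
  | none => 0

/-- A semistandard Young tableau with at most `n` rows (rows indexed `1,…,n`, row `j`
having `μ j` boxes, columns indexed from `0`), with entries in `{1,…,n}`, weakly
increasing along rows and strictly increasing down columns; entries outside the shape
are `0`. -/
structure SSYT (n : ℕ) (μ : ℕ → ℕ) where
  entry : ℕ → ℕ → ℕ
  entry_mem : ∀ j c, 1 ≤ j → j ≤ n → c < μ j → 1 ≤ entry j c ∧ entry j c ≤ n
  row_weak : ∀ j c₁ c₂, 1 ≤ j → j ≤ n → c₁ ≤ c₂ → c₂ < μ j → entry j c₁ ≤ entry j c₂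
  col_strict : ∀ j₁ j₂ c, 1 ≤ j₁ → j₁ < j₂ → j₂ ≤ n → c < μ j₂ → entry j₁ c < entry j₂ c
  outside : ∀ j c, j = 0 ∨ n < j ∨ μ j ≤ c → entry j c = 0

/-- `μ` is a partition with (at most) `n` parts `μ 1 ≥ μ 2 ≥ … ≥ μ n ≥ 0`
(and `μ j = 0` outside `1,…,n`). -/
def IsPartition (n : ℕ) (μ : ℕ → ℕ) : Prop :=
  (∀ j, 1 ≤ j → j < n → μ (j + 1) ≤ μ j) ∧ ∀ j, j = 0 ∨ n < j → μ j = 0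

/-- The reading word of a tableau: the rows read left to right, from the bottom row
to the top one. -/
def readingWord (n : ℕ) (μ : ℕ → ℕ) (Y : SSYT n μ) : List ℕ :=
  ((List.range n).reverse.map (· + 1)).flatMap fun j =>
    (List.range (μ j)).map fun c => Y.entry j c

/-- An elementary Knuth move. -/
def KnuthMove (w₁ w₂ : List ℕ) : Prop :=
  (∃ (u v : List ℕ) (x y z : ℕ), x < y ∧ y ≤ z ∧
      w₁ = u ++ y :: x :: z :: v ∧ w₂ = u ++ y :: z :: x :: v) ∨
  (∃ (u v : List ℕ) (x y z : ℕ), x ≤ y ∧ y < z ∧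
      w₁ = u ++ x :: z :: y :: v ∧ w₂ = u ++ z :: x :: y :: v)

/-- Knuth equivalence: the equivalence relation generated by elementary Knuth moves. -/
def KnuthEquiv (w₁ w₂ : List ℕ) : Prop := Relation.EqvGen KnuthMove w₁ w₂

/-- The monomial `x^R = ∏_{(i,k) ∈ R} x_k`. -/
def xR (R : Finset (ℤ × ℤ)) : MvPolynomial ℕ ℤ :=
  ∏ p ∈ R, MvPolynomial.X p.2.toNat

/-- The monomial `x^Y = ∏ x_i`, one factor for each entry `i` of `Y`. -/
def xY (n : ℕ) (μ : ℕ → ℕ) (Y : SSYT n μ) : MvPolynomial ℕ ℤ :=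
  ((readingWord n μ Y).map MvPolynomial.X).prod

/-- The Schubert polynomial `S_w = Σ_{R : w_R = w} x^R`. -/
def Schub (n : ℤ) (w : Equiv.Perm ℤ) : MvPolynomial ℕ ℤ :=
  ∑ᶠ R ∈ {R : Finset (ℤ × ℤ) | IsRC n R ∧ wR n R = w}, xR R

/-- The Schur polynomial `s_μ(x₁,…,x_n) = Σ_Y x^Y`, summing over all semistandard Young
tableaux of shape `μ` with entries in `{1,…,n}`. -/
def SchurP (n : ℕ) (μ : ℕ → ℕ) : MvPolynomial ℕ ℤ :=
  ∑ᶠ Y : SSYT n μ, xY n μ Y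

/-- The complete homogeneous symmetric polynomial
`h_m = Σ_{1 ≤ i₁ ≤ … ≤ i_m ≤ n} x_{i₁} ⋯ x_{i_m}`. -/
def hPoly (n m : ℕ) : MvPolynomial ℕ ℤ :=
  ∑ s ∈ (Finset.Icc 1 n).sym m, (s.1.map MvPolynomial.X).prod

/-- The top rc-graph `R(μ) = {(i,k) : 1 ≤ k ≤ n, n - μ_k + 1 ≤ i ≤ n}` of a partition. -/
def Rmu (n : ℕ) (μ : ℕ → ℕ) : Finset (ℤ × ℤ) :=
  (Finset.Icc 1 (n : ℤ)).biUnion fun k =>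
    (Finset.Icc ((n : ℤ) - μ k.toNat + 1) (n : ℤ)).image fun i => (i, k)


/-! ### Words and length -/

def wprod (l : List ℤ) : Equiv.Perm ℤ := (l.map sT).prod

lemma wprod_cons (c : ℤ) (l : List ℤ) : wprod (c :: l) = sT c * wprod l := by
  simp [wprod]

lemma wprod_append (l m : List ℤ) : wprod (l ++ m) = wprod l * wprod m := by
  simp [wprod]

lemma len_le (l : List ℤ) : len (wprod l) ≤ l.length :=
  Nat.sInf_le ⟨l, rfl, rfl⟩

lemma len_attained (l : List ℤ) : ∃ l', l'.length = len (wprod l) ∧ wprod l' = wprod l :=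
  Nat.sInf_mem (s := {m : ℕ | ∃ l' : List ℤ, l'.length = m ∧ (l'.map sT).prod = wprod l})
    ⟨l.length, l, rfl, rfl⟩

lemma len_mul_le (l m : List ℤ) : len (wprod l * wprod m) ≤ len (wprod l) + len (wprod m) := by
  obtain ⟨l', h1, h2⟩ := len_attained l
  obtain ⟨m', h3, h4⟩ := len_attained m
  rw [← h2, ← h4, ← wprod_append, h2, h4, ← h1, ← h3, ← List.length_append]
  exact len_le _

/-- If the order of `x,y` is reversed, then some letter of the word swaps their positions. -/
lemma exists_cross (l : List ℤ) (x y : ℤ) (hxy : x < y) (h : wprod l y < wprod l x) :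
    ∃ l1 c l2, l = l1 ++ c :: l2 ∧ wprod l2 x = c ∧ wprod l2 y = c + 1 := by
  induction l with
  | nil => simp [wprod] at h; omega
  | cons c l ih =>
    by_cases h2 : wprod l y < wprod l x
    · obtain ⟨l1, d, l2, rfl, h3⟩ := ih h2
      exact ⟨c :: l1, d, l2, rfl, h3⟩
    · refine ⟨[], c, l, rfl, ?_⟩
      have hne : wprod l x ≠ wprod l y := fun e => by
        have := (wprod l).injective e
        omega
      rw [wprod_cons] at h
      simp only [Equiv.Perm.mul_apply, sT, Equiv.swap_apply_def] at h
      split_ifs at h <;> omega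

lemma mul_swap_eq (w : Equiv.Perm ℤ) (x y : ℤ) :
    w * Equiv.swap x y = Equiv.swap (w x) (w y) * w := by
  ext z
  simp only [Equiv.Perm.mul_apply]
  rw [Equiv.swap_apply_def, Equiv.swap_apply_def]
  simp only [EmbeddingLike.apply_eq_iff_eq]
  split_ifs <;> rfl

/-- Length goes up under multiplication by a transposition of a noninversion. -/
lemma len_lt (l : List ℤ) (w : Equiv.Perm ℤ) (x y : ℤ) (hxy : x < y) (h : w x < w y)
    (hl : wprod l = w * Equiv.swap x y) : len w < len (w * Equiv.swap x y) := by
  obtain ⟨l', h1, h2⟩ := len_attained l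
  rw [← hl, ← h1]
  have h3 : wprod l' y < wprod l' x := by
    rw [h2, hl]; simpa using h
  obtain ⟨l1, c, l2, rfl, h4, h5⟩ := exists_cross l' x y hxy h3
  have h6 : wprod (l1 ++ l2) = w := by
    have : wprod (l1 ++ c :: l2) * Equiv.swap x y = w := by
      rw [h2, hl, mul_assoc, Equiv.swap_mul_self, mul_one]
    rw [← this, wprod_append, wprod_append, wprod_cons, mul_assoc, mul_assoc, mul_swap_eq,
      h4, h5, ← mul_assoc (sT c), sT, Equiv.swap_mul_self, one_mul]
  have h7 := len_le (l1 ++ l2)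
  rw [h6] at h7
  simp at h7 ⊢
  omega

/-! ### Finite sets of positions -/

def lett (n : ℤ) (p : ℤ × ℤ) : ℤ := p.1 + p.2 - n - 1

def wd (n : ℤ) (A : Finset (ℤ × ℤ)) : List ℤ := (A.sort rcOrder).map (lett n)

lemma wR_eq (n : ℤ) (A : Finset (ℤ × ℤ)) : wR n A = wprod (wd n A) := by
  simp [wR, wprod, wd, lett, List.map_map, Function.comp_def]

lemma wd_length (n : ℤ) (A : Finset (ℤ × ℤ)) : (wd n A).length = A.card := by
  simp [wd]

lemma len_wR_le (n : ℤ) (A : Finset (ℤ × ℤ)) : len (wR n A) ≤ A.card := by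
  rw [wR_eq, ← wd_length n]; exact len_le _

/-- `p` is strictly before `q` in the reading order. -/
def before (p q : ℤ × ℤ) : Prop := q.2 < p.2 ∨ (p.2 = q.2 ∧ p.1 < q.1)

lemma before_tri (p q : ℤ × ℤ) : before p q ∨ p = q ∨ before q p := by
  unfold before
  rw [Prod.ext_iff]; omega

lemma sort_eq_of (A : Finset (ℤ × ℤ)) (l : List (ℤ × ℤ)) (h : l.Pairwise before)
    (hA : ∀ p, p ∈ l ↔ p ∈ A) : A.sort rcOrder = l := by
  have hnd : l.Nodup := h.imp (fun {a b} hab => by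
    unfold before at hab
    rintro rfl
    omega)
  refine List.Perm.eq_of_pairwise' (r := rcOrder) ?_ (h.imp fun {a b} hab => by
    unfold before at hab; unfold rcOrder; omega) ?_
  · exact Finset.pairwise_sort A rcOrder
  · rw [List.perm_ext_iff_of_nodup (Finset.sort_nodup _ _) hnd]
    intro p
    rw [hA, Finset.mem_sort]

lemma sort_pairwise (A : Finset (ℤ × ℤ)) : (A.sort rcOrder).Pairwise before := by
  have h1 := Finset.pairwise_sort A rcOrder
  have h2 : (A.sort rcOrder).Pairwise (· ≠ ·) := Finset.sort_nodup A rcOrder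
  refine (h1.and h2).imp ?_
  rintro a b ⟨h3, h4⟩
  unfold rcOrder at h3; unfold before
  rw [Ne, Prod.ext_iff] at h4
  omega

lemma wd_union (n : ℤ) (A B : Finset (ℤ × ℤ)) (h : ∀ p ∈ A, ∀ q ∈ B, before p q) :
    wd n (A ∪ B) = wd n A ++ wd n B := by
  unfold wd
  rw [sort_eq_of (A ∪ B) (A.sort rcOrder ++ B.sort rcOrder), List.map_append]
  · rw [List.pairwise_append]
    refine ⟨sort_pairwise _, sort_pairwise _, ?_⟩
    intro a ha b hb
    exact h a (by simpa using ha) b (by simpa using hb)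
  · simp

lemma wR_union (n : ℤ) (A B : Finset (ℤ × ℤ)) (h : ∀ p ∈ A, ∀ q ∈ B, before p q) :
    wR n (A ∪ B) = wR n A * wR n B := by
  simp only [wR_eq]
  rw [wd_union n A B h, wprod_append]

lemma wR_single (n : ℤ) (p : ℤ × ℤ) : wR n {p} = sT (lett n p) := by
  simp [wR, lett]

lemma wR_empty (n : ℤ) : wR n ∅ = 1 := by
  simp [wR]

def bef (A : Finset (ℤ × ℤ)) (p : ℤ × ℤ) : Finset (ℤ × ℤ) := A.filter fun q => before q p
def aft (A : Finset (ℤ × ℤ)) (p : ℤ × ℤ) : Finset (ℤ × ℤ) := A.filter fun q => before p q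

lemma mem_bef {A : Finset (ℤ × ℤ)} {p q : ℤ × ℤ} : q ∈ bef A p ↔ q ∈ A ∧ before q p := by
  simp [bef]
lemma mem_aft {A : Finset (ℤ × ℤ)} {p q : ℤ × ℤ} : q ∈ aft A p ↔ q ∈ A ∧ before p q := by
  simp [aft]

lemma before_trans {p q r : ℤ × ℤ} (h1 : before p q) (h2 : before q r) : before p r := by
  unfold before at *; omega

lemma not_before_self (p : ℤ × ℤ) : ¬ before p p := by
  unfold before; omega

def U (n : ℤ) (A : Finset (ℤ × ℤ)) (p : ℤ × ℤ) : Equiv.Perm ℤ := wR n (aft A p)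

lemma wR_split (n : ℤ) (A : Finset (ℤ × ℤ)) (p : ℤ × ℤ) (hp : p ∉ A) :
    wR n A = wR n (bef A p) * U n A p := by
  unfold U
  rw [← wR_union]
  · congr 1
    ext q
    simp only [Finset.mem_union, mem_bef, mem_aft]
    have := before_tri q p
    constructor
    · intro h
      rcases this with h1 | h1 | h1
      · exact Or.inl ⟨h, h1⟩
      · exact absurd (h1 ▸ h) hp
      · exact Or.inr ⟨h, h1⟩
    · tauto
  · intro a ha b hb
    exact before_trans (mem_bef.1 ha).2 (mem_aft.1 hb).2

lemma wR_split_insert (n : ℤ) (A : Finset (ℤ × ℤ)) (p : ℤ × ℤ) (hp : p ∉ A) :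
    wR n (insert p A) = wR n (bef A p) * (sT (lett n p) * U n A p) := by
  unfold U
  rw [← wR_single, ← wR_union, ← wR_union]
  · congr 1
    ext q
    simp only [Finset.mem_union, mem_bef, mem_aft, Finset.mem_insert, Finset.mem_singleton]
    have := before_tri q p
    tauto
  · intro a ha b hb
    simp only [Finset.mem_union, mem_aft, Finset.mem_singleton] at hb
    rcases hb with rfl | hb
    · exact (mem_bef.1 ha).2
    · exact before_trans (mem_bef.1 ha).2 hb.2
  · intro a ha b hb
    rw [Finset.mem_singleton] at ha
    subst ha
    exact (mem_aft.1 hb).2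

lemma wR_insert (n : ℤ) (A : Finset (ℤ × ℤ)) (p : ℤ × ℤ) (hp : p ∉ A) (x y : ℤ)
    (hx : U n A p x = lett n p) (hy : U n A p y = lett n p + 1) :
    wR n (insert p A) = wR n A * Equiv.swap x y := by
  rw [wR_split_insert n A p hp, wR_split n A p hp, mul_assoc, mul_swap_eq (U n A p), hx, hy, sT]

lemma aft_insert_self (A : Finset (ℤ × ℤ)) (p : ℤ × ℤ) : aft (insert p A) p = aft A p := by
  ext q
  simp only [mem_aft, Finset.mem_insert]
  constructor
  · rintro ⟨rfl | h, h2⟩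
    · exact absurd h2 (not_before_self _)
    · exact ⟨h, h2⟩
  · tauto

lemma aft_erase_self (A : Finset (ℤ × ℤ)) (p : ℤ × ℤ) : aft (A.erase p) p = aft A p := by
  ext q
  simp only [mem_aft, Finset.mem_erase]
  constructor
  · tauto
  · rintro ⟨h, h2⟩
    refine ⟨⟨?_, h⟩, h2⟩
    rintro rfl
    exact not_before_self _ h2

lemma wR_erase (n : ℤ) (A : Finset (ℤ × ℤ)) (p : ℤ × ℤ) (hp : p ∈ A) (x y : ℤ)
    (hx : U n A p x = lett n p) (hy : U n A p y = lett n p + 1) :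
    wR n (A.erase p) = wR n A * Equiv.swap x y := by
  have h := wR_insert n (A.erase p) p (Finset.notMem_erase p A) x y
    (by rw [U, aft_erase_self]; exact hx) (by rw [U, aft_erase_self]; exact hy)
  rw [Finset.insert_erase hp] at h
  rw [h, mul_assoc, Equiv.swap_mul_self, mul_one]

lemma wR_fix (n : ℤ) (A : Finset (ℤ × ℤ)) (x : ℤ)
    (h : ∀ p ∈ A, lett n p ≠ x ∧ lett n p + 1 ≠ x) : wR n A x = x := by
  have key : ∀ l : List ℤ, (∀ c ∈ l, c ≠ x ∧ c + 1 ≠ x) → wprod l x = x := by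
    intro l
    induction l with
    | nil => intro _; simp [wprod]
    | cons c l ih =>
      intro hl
      rw [wprod_cons, Equiv.Perm.mul_apply, ih fun d hd => hl d (List.mem_cons_of_mem _ hd), sT]
      have := hl c List.mem_cons_self
      exact Equiv.swap_apply_of_ne_of_ne (Ne.symm this.1) (Ne.symm this.2)
  rw [wR_eq]
  apply key
  intro c hc
  simp only [wd, List.mem_map, Finset.mem_sort] at hc
  obtain ⟨p, hp, rfl⟩ := hc
  exact h p hp

/-- crossing lemma at the level of finite sets -/
lemma exists_cross_set (n : ℤ) (A : Finset (ℤ × ℤ)) (x y : ℤ) (hxy : x < y)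
    (h : wR n A y < wR n A x) :
    ∃ q ∈ A, U n A q x = lett n q ∧ U n A q y = lett n q + 1 := by
  rw [wR_eq] at h
  obtain ⟨l1, c, l2, h1, h2, h3⟩ := exists_cross _ x y hxy h
  unfold wd at h1
  rw [List.map_eq_append_iff] at h1
  obtain ⟨m1, m2', h4, h5, h6⟩ := h1
  rw [List.map_eq_cons_iff] at h6
  obtain ⟨q, m2, rfl, rfl, rfl⟩ := h6
  have hq : q ∈ A := by
    rw [← Finset.mem_sort rcOrder, h4]; simp
  have hs := sort_pairwise A
  rw [h4, List.pairwise_append, List.pairwise_cons] at hs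
  have haft : wd n (aft A q) = m2.map (lett n) := by
    unfold wd
    rw [sort_eq_of (aft A q) m2 hs.2.1.2]
    intro p
    rw [mem_aft, ← Finset.mem_sort rcOrder, h4]
    simp only [List.mem_append, List.mem_cons]
    constructor
    · intro hp
      exact ⟨Or.inr (Or.inr hp), hs.2.1.1 p hp⟩
    · rintro ⟨hp | rfl | hp, hb⟩
      · exact absurd (before_trans hb (hs.2.2 p hp q List.mem_cons_self)) (not_before_self _)
      · exact absurd hb (not_before_self _)
      · exact hp
  refine ⟨q, hq, ?_, ?_⟩
  · rw [U, wR_eq, haft, h2]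
  · rw [U, wR_eq, haft, h3]

/-- reduced sets -/
def Red (n : ℤ) (A : Finset (ℤ × ℤ)) : Prop := len (wR n A) = A.card

lemma Red.right {n : ℤ} {A B : Finset (ℤ × ℤ)} (h : ∀ p ∈ A, ∀ q ∈ B, before p q)
    (hr : Red n (A ∪ B)) : Red n B := by
  unfold Red at *
  have hd : Disjoint A B := by
    rw [Finset.disjoint_left]
    intro p hp hq
    exact not_before_self _ (h p hp p hq)
  rw [wR_union n A B h, Finset.card_union_of_disjoint hd] at hr
  have h1 := len_wR_le n A
  have h2 := len_wR_le n B
  have h3 := len_mul_le (wd n A) (wd n B)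
  rw [← wR_eq, ← wR_eq] at h3
  omega

lemma Red.filter {n : ℤ} {A : Finset (ℤ × ℤ)} (hr : Red n A) (P : ℤ × ℤ → Prop)
    (hP : ∀ p q, P p → before p q → P q) : Red n (A.filter P) := by
  apply Red.right (A := A.filter fun p => ¬ P p)
  · intro p hp q hq
    simp only [Finset.mem_filter] at hp hq
    rcases before_tri p q with h | rfl | h
    · exact h
    · exact absurd hq.2 hp.2
    · exact absurd (hP _ _ hq.2 h) hp.2
  · rw [Finset.union_comm, Finset.filter_union_filter_not_eq]
    exact hr

lemma Red.aft {n : ℤ} {A : Finset (ℤ × ℤ)} (hr : Red n A) (p : ℤ × ℤ) : Red n (aft A p) :=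
  hr.filter _ fun _ _ h1 h2 => before_trans h1 h2

lemma wR_len_lt {n : ℤ} {A B : Finset (ℤ × ℤ)} {x y : ℤ} (hxy : x < y)
    (h : wR n A x < wR n A y) (hB : wR n B = wR n A * Equiv.swap x y) :
    len (wR n A) < len (wR n B) := by
  rw [hB]
  exact len_lt (wd n B) _ x y hxy h (by rw [← hB, wR_eq])

def Good (n : ℤ) (A : Finset (ℤ × ℤ)) : Prop := ∀ p ∈ A, p.1 ≤ n ∧ p.2 ≤ n ∧ 1 ≤ p.2

lemma lab_eq (n : ℤ) (A : Finset (ℤ × ℤ)) (hA : Good n A) :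
    ∀ (m : ℕ) (i k : ℤ), i ≤ n → (n - i).toNat + k.toNat ≤ m →
      U n A (i, k) (lab n A true i k) = i + k - n ∧
      U n A (i, k) (lab n A false i k) = i + k - n - 1 := by
  intro m
  induction m using Nat.strong_induction_on with
  | _ m ih =>
  intro i k hi hm
  constructor
  · rw [lab]
    split_ifs with h1 h2
    · have : i = n := by omega
      subst this
      rw [U, wR_fix]
      · ring
      · intro p hp
        rw [mem_aft] at hp
        have := hA p hp.1
        have h3 := hp.2
        unfold before at h3
        unfold lett
        simp only at h3
        omega
    · have h3 := (ih _ (by omega : m - 1 < m) (i + 1) k (by omega) (by omega)).1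
      have h4 : aft A (i, k) = {(i + 1, k)} ∪ aft A (i + 1, k) := by
        ext ⟨a, b⟩
        simp only [mem_aft, Finset.mem_union, Finset.mem_singleton, before, Prod.mk.injEq]
        constructor
        · rintro ⟨h, h'⟩
          by_cases hh : a = i + 1 ∧ b = k
          · exact Or.inl hh
          · exact Or.inr ⟨h, by omega⟩
        · rintro (⟨rfl, rfl⟩ | ⟨h, h'⟩)
          · exact ⟨h2, by omega⟩
          · exact ⟨h, by omega⟩
      rw [U, h4, wR_union, wR_single, Equiv.Perm.mul_apply]
      · rw [U] at h3
        rw [h3, sT, lett, Equiv.swap_apply_def]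
        simp only
        split_ifs <;> omega
      · intro p hp q hq
        rw [Finset.mem_singleton] at hp
        subst hp
        exact (mem_aft.1 hq).2
    · have h3 := (ih _ (by omega : m - 1 < m) (i + 1) k (by omega) (by omega)).2
      have h4 : aft A (i, k) = aft A (i + 1, k) := by
        ext ⟨a, b⟩
        simp only [mem_aft, before]
        constructor
        · rintro ⟨h, h'⟩
          by_cases hh : a = i + 1 ∧ b = k
          · rw [hh.1, hh.2] at h; exact absurd h h2
          · exact ⟨h, by omega⟩
        · rintro ⟨h, h'⟩
          exact ⟨h, by omega⟩
      rw [U, h4, ← U, h3]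
      ring
  · rw [lab]
    have hfix : ∀ B : Finset (ℤ × ℤ), (∀ p ∈ B, p ∈ aft A (i, k) ∧ before p (i, k - 1)) →
        wR n B (i + k - n - 1) = i + k - n - 1 := by
      intro B hB
      apply wR_fix
      rintro ⟨a, b⟩ hp
      have := (hB _ hp).1
      rw [mem_aft] at this
      have h3 := this.2
      have h4 := (hB _ hp).2
      unfold before at h3 h4
      unfold lett
      simp only at *
      omega
    split_ifs with h1 h2
    · rw [U, wR_fix]
      intro p hp
      rw [mem_aft] at hp
      have := hA p hp.1
      have h3 := hp.2
      unfold before at h3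
      simp only at h3
      omega
    all_goals
      have h3 := ih _ (by omega : m - 1 < m) i (k - 1) (by omega) (by omega)
    · have h4 : aft A (i, k) = (aft A (i, k)).filter (fun p => before p (i, k - 1)) ∪
          ({(i, k - 1)} ∪ aft A (i, k - 1)) := by
        ext ⟨a, b⟩
        simp only [mem_aft, Finset.mem_union, Finset.mem_singleton, Prod.mk.injEq,
          Finset.mem_filter]
        simp only [before]
        constructor
        · rintro ⟨h, h'⟩
          by_cases hh : a = i ∧ b = k - 1
          · exact Or.inr (Or.inl hh)
          · by_cases hh2 : k - 1 < b ∨ b = k - 1 ∧ a < i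
            · exact Or.inl ⟨⟨h, h'⟩, hh2⟩
            · exact Or.inr (Or.inr ⟨h, by omega⟩)
        · rintro (h | ⟨rfl, rfl⟩ | ⟨h, h'⟩)
          · exact h.1
          · exact ⟨h2, by omega⟩
          · exact ⟨h, by omega⟩
      rw [U, h4, wR_union, wR_union, wR_single, Equiv.Perm.mul_apply, Equiv.Perm.mul_apply,
        ← U, h3.2]
      · have : sT (lett n (i, k - 1)) (i + (k - 1) - n - 1) = i + k - n - 1 := by
          rw [sT, lett, Equiv.swap_apply_def]
          simp only
          split_ifs <;> omega
        rw [this]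
        apply hfix
        intro p hp
        simpa using hp
      · intro p hp q hq
        rw [Finset.mem_singleton] at hp
        subst hp
        exact (mem_aft.1 hq).2
      · intro p hp q hq
        rw [Finset.mem_filter] at hp
        simp only [mem_aft, Finset.mem_union, Finset.mem_singleton] at hq
        rcases hq with rfl | hq
        · exact hp.2
        · exact before_trans hp.2 hq.2
    · have h4 : aft A (i, k) = (aft A (i, k)).filter (fun p => before p (i, k - 1)) ∪
          aft A (i, k - 1) := by
        ext ⟨a, b⟩
        simp only [mem_aft, Finset.mem_union, Finset.mem_filter]
        simp only [before]
        constructor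
        · rintro ⟨h, h'⟩
          by_cases hh : a = i ∧ b = k - 1
          · rw [hh.1, hh.2] at h; exact absurd h h2
          · by_cases hh2 : k - 1 < b ∨ b = k - 1 ∧ a < i
            · exact Or.inl ⟨⟨h, h'⟩, hh2⟩
            · exact Or.inr ⟨h, by omega⟩
        · rintro (h | ⟨h, h'⟩)
          · exact h.1
          · exact ⟨h, by omega⟩
      rw [U, h4, wR_union, Equiv.Perm.mul_apply, ← U, h3.1]
      · have : i + (k - 1) - n = i + k - n - 1 := by ring
        rw [this]
        apply hfix
        intro p hp
        simpa using hp
      · intro p hp q hq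
        rw [Finset.mem_filter] at hp
        exact before_trans hp.2 (mem_aft.1 hq).2

lemma lab_true {n : ℤ} {A : Finset (ℤ × ℤ)} (hA : Good n A) {q : ℤ × ℤ} (hq : q.1 ≤ n) :
    U n A q (lab n A true q.1 q.2) = lett n q + 1 := by
  rw [(lab_eq n A hA _ q.1 q.2 hq le_rfl).1, lett]; ring

lemma lab_false {n : ℤ} {A : Finset (ℤ × ℤ)} (hA : Good n A) {q : ℤ × ℤ} (hq : q.1 ≤ n) :
    U n A q (lab n A false q.1 q.2) = lett n q := by
  rw [(lab_eq n A hA _ q.1 q.2 hq le_rfl).2, lett]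

lemma lab_true_of {n : ℤ} {A : Finset (ℤ × ℤ)} (hA : Good n A) {q : ℤ × ℤ} (hq : q.1 ≤ n)
    {x : ℤ} (h : U n A q x = lett n q + 1) : lab n A true q.1 q.2 = x :=
  (U n A q).injective (by rw [lab_true hA hq, h])

lemma lab_false_of {n : ℤ} {A : Finset (ℤ × ℤ)} (hA : Good n A) {q : ℤ × ℤ} (hq : q.1 ≤ n)
    {x : ℤ} (h : U n A q x = lett n q) : lab n A false q.1 q.2 = x :=
  (U n A q).injective (by rw [lab_false hA hq, h])

lemma exists_open {n : ℤ} (A : Finset (ℤ × ℤ)) {l k : ℤ} (hl : l ≤ n) (hk : 1 ≤ k)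
    (h : lab n A true l k ≤ 0) : ∃ x, l < x ∧ OpenSpace n A x k := by
  by_contra hcon
  push Not at hcon
  have key : ∀ m : ℕ, l + m ≤ n → lab n A true (l + m) k ≤ 0 := by
    intro m
    induction m with
    | zero => intro _; simpa using h
    | succ m ih =>
      intro hm
      push_cast at hm ⊢
      have h1 := ih (by omega)
      have h2 := hcon (l + (m + 1)) (by omega)
      unfold OpenSpace at h2
      rw [lab] at h1
      rw [dif_neg (by omega), add_assoc] at h1
      split_ifs at h1 with h3
      · exact h1
      · by_contra h4
        exact h2 ⟨by omega, h3, h1, by omega⟩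
  have h1 := key (n - l).toNat (by omega)
  rw [show l + ((n - l).toNat : ℤ) = n by omega, lab, dif_pos le_rfl] at h1
  omega

lemma exists_low {n : ℤ} {A : Finset (ℤ × ℤ)} (hA : Good n A) (k : ℤ) :
    ∃ M, M ≤ n ∧ ∀ i ≤ M, lab n A true i k ≤ 0 := by
  obtain ⟨B, hB⟩ : ∃ B : ℤ, ∀ p ∈ A, B ≤ lett n p := by
    obtain ⟨B, hB⟩ := (A.image (lett n)).bddBelow
    exact ⟨B, fun p hp => hB (by simpa using ⟨p.1, p.2, hp, rfl⟩)⟩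
  refine ⟨min n (min (n - k) (B - 1 + n - k)), by omega, fun i hi => ?_⟩
  have : lab n A true i k = i + k - n := by
    apply lab_true_of hA (q := (i, k)) (by simp only; omega)
    rw [U, wR_fix]
    · simp [lett]
    · intro p hp
      have := hB p (mem_aft.1 hp).1
      omega
  omega

lemma Good.insert {n : ℤ} {A : Finset (ℤ × ℤ)} (hA : Good n A) {p : ℤ × ℤ}
    (h : p.1 ≤ n ∧ p.2 ≤ n ∧ 1 ≤ p.2) : Good n (insert p A) := by
  intro q hq
  rw [Finset.mem_insert] at hq
  rcases hq with rfl | hq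
  · exact h
  · exact hA q hq

lemma Good.erase {n : ℤ} {A : Finset (ℤ × ℤ)} (hA : Good n A) (p : ℤ × ℤ) :
    Good n (A.erase p) := fun q hq => hA q (Finset.mem_of_mem_erase hq)

/-- The other crossing exists when the new diagram is not reduced. -/
lemma exists_other {n : ℤ} {T : Finset (ℤ × ℤ)} {p : ℤ × ℤ} (hT : Red n T)
    (hp : p ∉ T) {a b : ℤ} (hba : b < a) (ha : U n T p a = lett n p + 1)
    (hb : U n T p b = lett n p) (hnr : ¬ Red n (insert p T)) :
    ∃ q ∈ insert p T, q ≠ p ∧ U n (insert p T) q a = lett n q ∧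
      U n (insert p T) q b = lett n q + 1 := by
  have hw := wR_insert n T p hp b a hb ha
  have h1 : wR n T a < wR n T b := by
    by_contra hcon
    have hne : wR n T a ≠ wR n T b := fun e => by
      have := (wR n T).injective e
      omega
    have h2 := wR_len_lt hba (by omega) hw
    have h3 := len_wR_le n (insert p T)
    unfold Red at hnr hT
    rw [Finset.card_insert_of_notMem hp] at h3 hnr
    omega
  rw [wR_split n T p hp, Equiv.Perm.mul_apply, Equiv.Perm.mul_apply, ha, hb] at h1
  obtain ⟨q, hq, h2, h3⟩ := exists_cross_set n (bef T p) _ _ (by omega) h1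
  have hq' := mem_bef.1 hq
  have hUq : U n (insert p T) q = U n (bef T p) q * (sT (lett n p) * U n T p) := by
    rw [U, U, U, ← wR_single, ← wR_union, ← wR_union]
    · congr 1
      ext r
      simp only [mem_aft, mem_bef, Finset.mem_insert, Finset.mem_union, Finset.mem_singleton]
      constructor
      · rintro ⟨rfl | hr, hb⟩
        · tauto
        · rcases before_tri r p with h | h | h <;> tauto
      · rintro (h | rfl | h)
        · tauto
        · exact ⟨Or.inl rfl, hq'.2⟩
        · exact ⟨Or.inr h.1, before_trans hq'.2 h.2⟩
    · intro x hx y hy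
      simp only [mem_aft, mem_bef, Finset.mem_union, Finset.mem_singleton] at hx hy
      rcases hy with rfl | hy
      · exact hx.1.2
      · exact before_trans hx.1.2 hy.2
    · intro x hx y hy
      simp only [mem_aft, Finset.mem_singleton] at hx hy
      subst hx
      exact hy.2
  refine ⟨q, Finset.mem_insert_of_mem hq'.1, ?_, ?_, ?_⟩
  · rintro rfl; exact hp hq'.1
  · rw [hUq, Equiv.Perm.mul_apply, Equiv.Perm.mul_apply, ha, sT, Equiv.swap_apply_right, h2]
  · rw [hUq, Equiv.Perm.mul_apply, Equiv.Perm.mul_apply, hb, sT, Equiv.swap_apply_left, h3]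

lemma swap_cases {n : ℤ} {A : Finset (ℤ × ℤ)} {q : ℤ × ℤ} {a b : ℤ}
    (h : (U n A q a = lett n q + 1 ∧ U n A q b = lett n q) ∨
         (U n A q b = lett n q + 1 ∧ U n A q a = lett n q)) (hq : q ∈ A) :
    wR n (A.erase q) = wR n A * Equiv.swap b a := by
  rcases h with h | h
  · exact wR_erase n A q hq b a h.2 h.1
  · rw [wR_erase n A q hq a b h.2 h.1, Equiv.swap_comm]

/-- Properties of the other crossing. -/
lemma other_props {n : ℤ} {T : Finset (ℤ × ℤ)} {p q : ℤ × ℤ} (hT : Red n T)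
    (hp : p ∉ T) {a b : ℤ} (hba : b < a) (ha : U n T p a = lett n p + 1)
    (hb : U n T p b = lett n p) (hq : q ∈ insert p T) (hqp : q ≠ p)
    (hU : (U n (insert p T) q a = lett n q + 1 ∧ U n (insert p T) q b = lett n q) ∨
         (U n (insert p T) q b = lett n q + 1 ∧ U n (insert p T) q a = lett n q)) :
    p.2 < q.2 ∧ U n (insert p T) q b = lett n q + 1 ∧
      wR n ((insert p T).erase q) = wR n T ∧ Red n ((insert p T).erase q) := by
  have hqT : q ∈ T := by
    rw [Finset.mem_insert] at hq; tauto
  have hw := wR_insert n T p hp b a hb ha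
  have hw' : wR n ((insert p T).erase q) = wR n T := by
    rw [swap_cases hU hq, hw, mul_assoc, Equiv.swap_mul_self, mul_one]
  have hred : Red n ((insert p T).erase q) := by
    unfold Red at *
    rw [hw', hT, Finset.card_erase_of_mem hq, Finset.card_insert_of_notMem hp]
    rfl
  -- `q` comes before `p` in the reading order
  have hbef : before q p := by
    rcases before_tri q p with h | h | h
    · exact h
    · exact absurd h hqp
    · exfalso
      have hUe : U n (insert p T) q = U n (aft T p) q := by
        unfold U
        congr 1
        ext r
        simp only [mem_aft, Finset.mem_insert]
        constructor
        · rintro ⟨hr | hr, hbb⟩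
          · rw [hr] at hbb
            exact absurd (before_trans h hbb) (not_before_self _)
          · exact ⟨⟨hr, before_trans h hbb⟩, hbb⟩
        · tauto
      rw [hUe] at hU
      have hqa : q ∈ aft T p := mem_aft.2 ⟨hqT, h⟩
      have h1 := swap_cases hU hqa
      have h2 := wR_len_lt hba (by
        change U n T p b < U n T p a
        rw [ha, hb]; omega) h1
      have h3 := hT.aft p
      unfold Red at h3
      have h4 := len_wR_le n ((aft T p).erase q)
      rw [Finset.card_erase_of_mem hqa] at h4
      omega
  have hUq : U n (insert p T) q = wR n ((aft T q).filter fun r => before r p) *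
      (sT (lett n p) * U n T p) := by
    rw [U, U, ← wR_single, ← wR_union, ← wR_union]
    · congr 1
      ext r
      simp only [mem_aft, Finset.mem_insert, Finset.mem_union, Finset.mem_singleton,
        Finset.mem_filter]
      constructor
      · rintro ⟨rfl | hr, hb⟩
        · tauto
        · rcases before_tri r p with h | h | h <;> tauto
      · rintro (h | rfl | h)
        · tauto
        · exact ⟨Or.inl rfl, hbef⟩
        · exact ⟨Or.inr h.1, before_trans hbef h.2⟩
    · intro x hx y hy
      simp only [mem_aft, Finset.mem_union, Finset.mem_singleton, Finset.mem_filter] at hx hy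
      rcases hy with rfl | hy
      · exact hx.2
      · exact before_trans hx.2 hy.2
    · intro x hx y hy
      simp only [mem_aft, Finset.mem_singleton] at hx hy
      subst hx
      exact hy.2
  refine ⟨?_, ?_, hw', hred⟩
  · by_contra hcon
    have hrow : q.2 = p.2 ∧ q.1 < p.1 := by
      unfold before at hbef; omega
    have h1 : U n (insert p T) q b = lett n p + 1 := by
      rw [hUq, Equiv.Perm.mul_apply, Equiv.Perm.mul_apply, hb, sT, Equiv.swap_apply_left]
      apply wR_fix
      intro r hr
      simp only [mem_aft, Finset.mem_filter] at hr
      simp only [before] at hr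
      unfold lett
      omega
    rw [h1] at hU
    unfold lett at hU
    omega
  · rcases hU with hU | hU
    · exfalso
      -- the suffix of `T` ending with `q` would not be reduced
      have hpa : p ∉ aft T q := fun h => hp (mem_aft.1 h).1
      have hUp : U n (aft T q) p = U n T p := by
        unfold U
        congr 1
        ext r
        simp only [mem_aft]
        constructor
        · tauto
        · rintro ⟨h1, h2⟩
          exact ⟨⟨h1, before_trans hbef h2⟩, h2⟩
      have hins : insert p (aft T q) = aft (insert p T) q := by
        ext r
        simp only [mem_aft, Finset.mem_insert]
        constructor
        · rintro (rfl | h)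
          · exact ⟨Or.inl rfl, hbef⟩
          · tauto
        · tauto
      have hv := wR_insert n (aft T q) p hpa b a (by rw [hUp, hb]) (by rw [hUp, ha])
      rw [hins] at hv
      -- hv : U(insert p T) q = U T q * swap b a
      have hv' : U n (insert p T) q = U n T q * Equiv.swap b a := hv
      have hTb : U n T q b = lett n q + 1 := by
        have := hU.1
        rw [hv', Equiv.Perm.mul_apply, Equiv.swap_apply_right] at this
        exact this
      have hTa : U n T q a = lett n q := by
        have := hU.2
        rw [hv', Equiv.Perm.mul_apply, Equiv.swap_apply_left] at this
        exact this
      have hqn : q ∉ aft T q := fun h => not_before_self _ (mem_aft.1 h).2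
      have hUU : U n (aft T q) q = U n T q := by
        unfold U
        congr 1
        ext r
        simp only [mem_aft]
        tauto
      have hs := wR_insert n (aft T q) q hqn a b (by rw [hUU, hTa]) (by rw [hUU, hTb])
      have hR : Red n (insert q (aft T q)) := by
        have := hT.filter (fun r => r = q ∨ before q r) (by
          rintro x y (rfl | h) h2
          · exact Or.inr h2
          · exact Or.inr (before_trans h h2))
        convert this using 1
        ext r
        simp only [mem_aft, Finset.mem_insert, Finset.mem_filter]
        constructor
        · rintro (rfl | h)
          · exact ⟨hqT, Or.inl rfl⟩
          · tauto
        · tauto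
      have hs2 : wR n (aft T q) = wR n (insert q (aft T q)) * Equiv.swap b a := by
        rw [hs, mul_assoc, Equiv.swap_comm a b, Equiv.swap_mul_self, mul_one]
      have h1 := wR_len_lt hba (by
        rw [hs, Equiv.Perm.mul_apply, Equiv.Perm.mul_apply, Equiv.swap_apply_left,
          Equiv.swap_apply_right]
        change U n T q a < U n T q b
        omega) hs2
      have h2 := len_wR_le n (aft T q)
      unfold Red at hR
      rw [Finset.card_insert_of_notMem hqn] at hR
      omega
    · exact hU.1

lemma good_of_star {n : ℤ} {R : Finset (ℤ × ℤ)} (hR : IsRC n R) (hS : Star n R) : Good n R := by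
  have h1 : ∀ p ∈ R, 1 ≤ p.2 := by
    by_contra hcon
    push Not at hcon
    obtain ⟨p, hp, hp1⟩ := hcon
    -- the last element in the reading order
    have hne : R.sort rcOrder ≠ [] := by
      intro h
      have := (Finset.mem_sort rcOrder).2 hp
      rw [h] at this
      simp at this
    set q := (R.sort rcOrder).getLast hne with hq
    have hqR : q ∈ R := (Finset.mem_sort rcOrder).1 (List.getLast_mem hne)
    have hlast : ∀ r ∈ R, ¬ before q r := by
      intro r hr hb
      have hs := sort_pairwise R
      rw [← List.dropLast_append_getLast hne, List.pairwise_append] at hs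
      have hr' := (Finset.mem_sort rcOrder).2 hr
      rw [← List.dropLast_append_getLast hne, List.mem_append, List.mem_singleton] at hr'
      rcases hr' with h | h
      · exact not_before_self _ (before_trans hb (hs.2.2 r h q (by simp [hq])))
      · rw [h] at hb
        exact not_before_self _ hb
    have hq1 : q.2 ≤ 0 := by
      have := hlast p hp
      unfold before at this
      omega
    have haft : aft R q = ∅ := by
      ext r
      simp only [mem_aft, Finset.notMem_empty, iff_false]
      rintro ⟨h1, h2⟩
      exact hlast r h1 h2
    have hU : U n R q = 1 := by rw [U, haft, wR_empty]
    have he := wR_erase n R q hqR (lett n q) (lett n q + 1) (by rw [hU]; rfl) (by rw [hU]; rfl)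
    have hst := hS (lett n q + 1) (by
      have := (hR.1 q hqR).1
      unfold lett; omega)
    rw [add_sub_cancel_right] at hst
    have h2 := wR_len_lt (by omega) hst he
    have h3 := len_wR_le n (R.erase q)
    rw [Finset.card_erase_of_mem hqR] at h3
    have := hR.2
    omega
  intro p hp
  exact ⟨(hR.1 p hp).1, (hR.1 p hp).2, h1 p hp⟩

lemma csInf_mem_int {s : Set ℤ} (h : s.Nonempty) (hb : BddBelow s) : sInf s ∈ s :=
  Int.csInf_mem h hb

lemma isRC_iff {n : ℤ} {A : Finset (ℤ × ℤ)} (hA : Good n A) : IsRC n A ↔ Red n A := by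
  unfold IsRC Red
  constructor
  · exact fun h => h.2
  · exact fun h => ⟨fun p hp => ⟨(hA p hp).1, (hA p hp).2.1⟩, h⟩

lemma loop (n : ℤ) : ∀ (fuel : ℕ) (T : Finset (ℤ × ℤ)) (p : ℤ × ℤ), Good n T → Red n T →
    1 ≤ p.2 → p.2 ≤ n → OpenSpace n T p.1 p.2 → (n + 1 - p.2).toNat ≤ fuel →
    ∃ e, (insertSteps n fuel (insert p T) p).getLast? = some e ∧
      ∃ c d : ℤ, 0 < c ∧ d ≤ 0 ∧ wR n e.1 = wR n T * Equiv.swap c d ∧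
        len (wR n e.1) = len (wR n T) + 1 := by
  intro fuel
  induction fuel with
  | zero => intro T p _ _ _ h1 _ h2; omega
  | succ fuel ih =>
    intro T p hG hT hp1 hpn hopen hfuel
    obtain ⟨ho1, hpT, ho3, ho4⟩ := hopen
    have hpT : p ∉ T := hpT
    have hG' : Good n (insert p T) := hG.insert ⟨ho1, hpn, hp1⟩
    have hUp : U n (insert p T) p = U n T p := by rw [U, aft_insert_self, U]
    have ha := lab_true hG ho1
    have hb := lab_false hG ho1
    have ha' : lab n (insert p T) true p.1 p.2 = lab n T true p.1 p.2 :=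
      lab_true_of hG' ho1 (by rw [hUp, ha])
    have hb' : lab n (insert p T) false p.1 p.2 = lab n T false p.1 p.2 :=
      lab_false_of hG' ho1 (by rw [hUp, hb])
    rw [insertSteps]
    simp only [ha', hb']
    generalize lab n T true p.1 p.2 = a at *
    generalize lab n T false p.1 p.2 = b at *
    have hba : b < a := by omega
    have hw := wR_insert n T p hpT b a hb ha
    by_cases hRC : IsRC n (insert p T)
    · rw [if_pos hRC]
      refine ⟨(insert p T, p), rfl, a, b, ho4, ho3, ?_, ?_⟩
      · simp only
        rw [hw, Equiv.swap_comm]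
      · have := hRC.2
        simp only
        rw [this, Finset.card_insert_of_notMem hpT, hT]
    · rw [if_neg hRC]
      have hnr : ¬ Red n (insert p T) := fun h => hRC ((isRC_iff hG').2 h)
      set C := (insert p T).filter fun q =>
            q ≠ p ∧ ((lab n (insert p T) true q.1 q.2 = a ∧ lab n (insert p T) false q.1 q.2 = b) ∨
                     (lab n (insert p T) true q.1 q.2 = b ∧ lab n (insert p T) false q.1 q.2 = a))
        with hC
      have hCne : C.sort rcOrder ≠ [] := by
        obtain ⟨q, hq, hqp, h1, h2⟩ := exists_other hT hpT hba ha hb hnr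
        have hqC : q ∈ C := by
          rw [hC, Finset.mem_filter]
          exact ⟨hq, hqp, Or.inr ⟨lab_true_of hG' (hG' q hq).1 h2,
            lab_false_of hG' (hG' q hq).1 h1⟩⟩
        intro h
        have := (Finset.mem_sort rcOrder).2 hqC
        rw [h] at this
        simp at this
      have hqC : (C.sort rcOrder).headI ∈ C := by
        rw [← Finset.mem_sort rcOrder]
        generalize C.sort rcOrder = l at *
        cases l with
        | nil => exact absurd rfl hCne
        | cons x l => simp
      generalize (C.sort rcOrder).headI = q at *
      rw [hC, Finset.mem_filter] at hqC
      obtain ⟨hq, hqp, hlabs⟩ := hqC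
      have hqn := hG' q hq
      have hlt := lab_true hG' hqn.1
      have hlf := lab_false hG' hqn.1
      obtain ⟨hrow, hUb, hw', hred⟩ := other_props hT hpT hba ha hb hq hqp (by
        rcases hlabs with ⟨h1, h2⟩ | ⟨h1, h2⟩
        · rw [h1] at hlt; rw [h2] at hlf; exact Or.inl ⟨hlt, hlf⟩
        · rw [h1] at hlt; rw [h2] at hlf; exact Or.inr ⟨hlt, hlf⟩)
      have hG'' := hG'.erase q
      have hwest : lab n ((insert p T).erase q) true q.1 q.2 = b :=
        lab_true_of hG'' hqn.1 (by rw [U, aft_erase_self]; exact hUb)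
      obtain ⟨x, hx1, hx2⟩ := exists_open ((insert p T).erase q) hqn.1 hqn.2.2 (by omega)
      have hmem := csInf_mem_int
        (s := {x : ℤ | q.1 < x ∧ OpenSpace n ((insert p T).erase q) x q.2})
        ⟨x, hx1, hx2⟩ ⟨q.1, fun y hy => hy.1.le⟩
      generalize sInf {x : ℤ | q.1 < x ∧ OpenSpace n ((insert p T).erase q) x q.2} = i' at *
      obtain ⟨e, he, c, d, hc, hd, h1, h2⟩ := ih ((insert p T).erase q) (i', q.2) hG'' hred
        hqn.2.2 hqn.2.1 hmem.2 (by simp only; omega)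
      refine ⟨e, ?_, c, d, hc, hd, ?_, ?_⟩
      · rw [List.getLast?_cons, he]; rfl
      · rw [h1, hw']
      · rw [h2, hw']

/-- For an rc-graph `R` satisfying (*) and `1 ≤ k ≤ n`, there are
integers `c > 0 ≥ d` with `w_{R←k} = w_R · s_{c,d}` and `ℓ(w_{R←k}) = ℓ(w_R) + 1`. -/
theorem insertOne_transposition (n : ℕ) (hn : 0 < n) (R : Finset (ℤ × ℤ))
    (hR : IsRC n R) (hS : Star n R) (k : ℤ) (hk1 : 1 ≤ k) (hkn : k ≤ n) :
    ∃ c d : ℤ, 0 < c ∧ d ≤ 0 ∧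
      wR n (insertOne n R k) = wR n R * Equiv.swap c d ∧
      len (wR n (insertOne n R k)) = len (wR n R) + 1 := by
  have hG := good_of_star hR hS
  obtain ⟨M, hM1, hM2⟩ := exists_low hG k
  obtain ⟨x, -, hx⟩ := exists_open R hM1 hk1 (hM2 M le_rfl)
  have hmem := csInf_mem_int (s := {x : ℤ | OpenSpace n R x k}) ⟨x, hx⟩
    ⟨M, fun y hy => by
      by_contra hcon
      have h1 := hM2 y (by omega)
      have h2 := hy.2.2.2
      omega⟩
  obtain ⟨e, he, c, d, hc, hd, h1, h2⟩ := loop n ((n + 1 - k).toNat + 1) R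
    (sInf {x : ℤ | OpenSpace n R x k}, k) hG hR.2 hk1 hkn hmem (by simp only; omega)
  have hi : insertOne n R k = e.1 := by
    unfold insertOne insertStepsOf
    simp only
    rw [he]
    rfl
  rw [hi]
  exact ⟨c, d, hc, hd, h1, h2⟩

end RCGraphs
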